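/- (Identity theorem) Let Ω ⊆ ℝ^{p+q+1} be a slice domain and let f, g : Ω → ℝ_{p+q} be left generalized partial-slice monogenic functions of type (p,q). If there exists ω ∈ 𝕊 such that f = g on a (p+1)-dimensional smooth submanifold contained in Ω_ω, then f ≡ g on Ω. -/

import Mathlib

/-!
Common framework for generalized partial-slice monogenic functions
(Xu–Sabadini, "On the Fueter-Sce theorem for generalized partial-slice
monogenic functions").

The real Clifford algebra `ℝ_{p+q}` is formalized as the Mathlib Clifford
algebra of the negative-definite quadratic form on `ℝ^{p+q}`; since Mathlib
provides no canonical norm on it, all analytic statements are phrased for an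
arbitrary normed real algebra `A` together with an `ℝ`-algebra isomorphism
`ξ : A ≃ₐ[ℝ] Cl (p+q)`.  A point of `ℝ^{p+q+1}` is a pair
`(𝐱_p, 𝐱_q) : (Fin (p+1) → ℝ) × EuclideanSpace ℝ (Fin q)`, and a point of a
slice `ℝ^{p+2}` is a pair `(𝐱_p, r)`.
-/

noncomputable section

open Filter Topology MeasureTheory Metric
open scoped Nat RealInnerProductSpace

namespace GPS

/-- The negative definite quadratic form `-(x₁² + ⋯ + xₙ²)` on `ℝⁿ`. -/
def Qe (n : ℕ) : QuadraticForm ℝ (Fin n → ℝ) :=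
  QuadraticMap.weightedSumSquares ℝ (fun _ : Fin n => (-1 : ℝ))

/-- The real Clifford algebra `ℝ_n`. -/
abbrev Cl (n : ℕ) : Type := CliffordAlgebra (Qe n)

/-- The generators `e_1, …, e_n` of `ℝ_n` (indexed by `Fin n`). -/
def e (n : ℕ) (i : Fin n) : Cl n := CliffordAlgebra.ι (Qe n) (Pi.single i 1)

variable (p q : ℕ)

/-- `ℝ^{p+1}`, the "slice-axis" space. -/
abbrev Vp : Type := Fin (p + 1) → ℝ

/-- `ℝ^q`. -/
abbrev Vq : Type := EuclideanSpace ℝ (Fin q)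

/-- `ℝ^{p+q+1} = ℝ^{p+1} ⊕ ℝ^q`. -/
abbrev V : Type := Vp p × Vq q

/-- `ℝ^{p+2}`, the parameter space `(𝐱_p, r)` of a slice. -/
abbrev Sl : Type := Vp p × ℝ

/-- The sphere `𝕊` of unit 1-vectors, described by their coordinate vectors
`(x_{p+1}, …, x_{p+q}) ∈ ℝ^q` with `∑ x_i² = 1`. -/
def S : Set (Vq q) := {v | ∑ j, v j ^ 2 = 1}

/-- The point `𝐱_p + r ω` of `ℝ^{p+q+1}`. -/
def spt (v : Vq q) (z : Sl p) : V p q := (z.1, z.2 • v)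

/-- The (parameterized) slice `Ω_ω` of a set `Ω ⊆ ℝ^{p+q+1}`. -/
def sliceSet (Ω : Set (V p q)) (v : Vq q) : Set (Sl p) := {z | spt p q v z ∈ Ω}

/-- `Ω₀* = {𝐱_p + 𝐱_q : 𝐱_p ∈ Ω₀, 𝐱_q ∈ ℝ^q}`. -/
def star0 (Ω₀ : Set (Vp p)) : Set (V p q) := {z | z.1 ∈ Ω₀}

/-- The p-symmetric completion `Ω_D` of a set `D ⊆ ℝ^{p+2}`. -/
def completion (D : Set (Sl p)) : Set (V p q) :=
  {x | ∃ z ∈ D, ∃ v ∈ S q, x = spt p q v z}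

/-- `D` is invariant under the reflection of the `(p+2)`-th variable. -/
def ReflInv (D : Set (Sl p)) : Prop := ∀ z ∈ D, ((z.1, -z.2) : Sl p) ∈ D

/-- A domain: a nonempty open connected set. -/
def IsDomain {E : Type*} [TopologicalSpace E] (s : Set E) : Prop :=
  IsOpen s ∧ IsConnected s

/-- A slice domain. -/
def IsSliceDomain (Ω : Set (V p q)) : Prop :=
  IsDomain Ω ∧ (∃ x : Vp p, ((x, 0) : V p q) ∈ Ω) ∧
    ∀ v ∈ S q, IsDomain (sliceSet p q Ω v)

/-- Partial symmetry with respect to `ℝ^{p+1}`. -/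
def IsPSymmetric (Ω : Set (V p q)) : Prop :=
  ∀ (x : Vp p) (r : ℝ), ∀ v ∈ S q, ∀ w ∈ S q,
    ((x, r • v) : V p q) ∈ Ω → ((x, r • w) : V p q) ∈ Ω

/-- A `d`-dimensional smooth submanifold of a real normed space. -/
def IsSmoothSubmanifoldDim {E : Type*} [NormedAddCommGroup E] [NormedSpace ℝ E]
    (d : ℕ) (M : Set E) : Prop :=
  ∀ x ∈ M, ∃ U : Set E, IsOpen U ∧ x ∈ U ∧
    ∃ (ψ : (Fin d → ℝ) → E) (W : Set (Fin d → ℝ)), IsOpen W ∧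
      ContDiffOn ℝ (⊤ : ℕ∞) ψ W ∧ Set.InjOn ψ W ∧
      (∀ y ∈ W, Function.Injective (fderivWithin ℝ ψ W y)) ∧
      M ∩ U = ψ '' W

variable {A : Type*} [NormedRing A] [NormedAlgebra ℝ A] (ξ : A ≃ₐ[ℝ] Cl (p + q))

/-- The generators `e_1, …, e_{p+q}` inside `A`. -/
def gen (i : Fin (p + q)) : A := ξ.symm (e (p + q) i)

/-- The generators `e_{p+1}, …, e_{p+q}` (the "q-part"). -/
def eQ (j : Fin q) : A := gen p q ξ ⟨p + (j : ℕ), by have := j.isLt; omega⟩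

/-- The generators `e_1, …, e_p` (the "p-part", without `e_0 = 1`). -/
def eP (i : Fin p) : A := gen p q ξ ⟨(i : ℕ), by have := i.isLt; omega⟩

/-- `e_0 = 1, e_1, …, e_p`: the paravector basis of `ℝ^{p+1}` inside `A`. -/
def εp (i : Fin (p + 1)) : A :=
  if h : (i : ℕ) = 0 then 1 else gen p q ξ ⟨(i : ℕ) - 1, by have := i.isLt; omega⟩

/-- The 1-vector `∑ x_i e_{p+i} ∈ A` corresponding to `𝐱_q ∈ ℝ^q`;
for a unit `v` this is the imaginary unit `ω ∈ 𝕊`. -/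
def ωCl (v : Vq q) : A := ∑ j, v j • eQ p q ξ j

/-- The paravector `x_0 + x_1 e_1 + ⋯ + x_p e_p ∈ A` of `𝐱_p ∈ ℝ^{p+1}`. -/
def clP (x : Vp p) : A := ∑ i, x i • εp p q ξ i

/-- The paravector of `𝐱 ∈ ℝ^{p+q+1}` in `A`. -/
def toCl (z : V p q) : A := clP p q ξ z.1 + ωCl p q ξ z.2

section SliceOperators

variable {F' : Type*} [NormedAddCommGroup F'] [NormedSpace ℝ F']

/-- `∂_{x_i}` on functions on `ℝ^{p+2}`. -/
def pdSl (i : Fin (p + 1)) (F : Sl p → F') : Sl p → F' :=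
  fun z => fderiv ℝ F z (Pi.single i 1, 0)

/-- `∂_r` on functions on `ℝ^{p+2}`. -/
def pdr (F : Sl p → F') : Sl p → F' := fun z => fderiv ℝ F z (0, 1)

/-- `∂_{x_i}` (first factor) on functions on `ℝ^{p+q+1}`. -/
def pdV1 (i : Fin (p + 1)) (f : V p q → F') : V p q → F' :=
  fun z => fderiv ℝ f z ((Pi.single i 1 : Vp p), 0)

/-- `∂_{x_{p+j}}` (second factor) on functions on `ℝ^{p+q+1}`. -/
def pdV2 (j : Fin q) (f : V p q → F') : V p q → F' :=
  fun z => fderiv ℝ f z (0, EuclideanSpace.single j 1)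

/-- `∂_{x_i}` on functions on `ℝ^{p+1}`. -/
def pdP (i : Fin (p + 1)) (g : Vp p → F') : Vp p → F' :=
  fun x => fderiv ℝ g x (Pi.single i 1)

/-- The Laplacian `Δ_{𝐱'} = Δ_{𝐱_p} + ∂_r²` on `ℝ^{p+2}`. -/
def LapSl (F : Sl p → F') : Sl p → F' :=
  fun z => ∑ i, pdSl p (i := i) (pdSl p i F) z + pdr p (pdr p F) z

/-- The Laplacian `Δ_𝐱` on `ℝ^{p+q+1}`. -/
def LapV (f : V p q → F') : V p q → F' :=
  fun z => ∑ i, pdV1 p q i (pdV1 p q i f) z + ∑ j, pdV2 p q j (pdV2 p q j f) z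

/-- The Laplacian `Δ_{𝐱_p}` on `ℝ^{p+1}`. -/
def LapP (g : Vp p → F') : Vp p → F' :=
  fun x => ∑ i, pdP p i (pdP p i g) x

end SliceOperators

/-- The generalized Cauchy–Riemann operator `D_{𝐱_p} = ∑_{i=0}^p e_i ∂_{x_i}`
on slice functions. -/
def DP (F : Sl p → A) : Sl p → A :=
  fun z => ∑ i, εp p q ξ i * pdSl p i F z

/-- The conjugated operator `D̄_{𝐱_p} = ∂_{x_0} - ∑_{i=1}^p e_i ∂_{x_i}`. -/
def DPbar (F : Sl p → A) : Sl p → A :=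
  fun z => pdSl p 0 F z - ∑ i : Fin p, eP p q ξ i * pdSl p i.succ F z

/-- The generalized Cauchy–Riemann (Dirac) operator `D_𝐱` on `ℝ^{p+q+1}`. -/
def DV (f : V p q → A) : V p q → A :=
  fun z => ∑ i, εp p q ξ i * pdV1 p q i f z + ∑ j, eQ p q ξ j * pdV2 p q j f z

/-- `D_{𝐱_p} = ∑_{i=0}^p e_i ∂_{x_i}` on functions on `ℝ^{p+1}`. -/
def DPfun (g : Vp p → A) : Vp p → A :=
  fun x => ∑ i, εp p q ξ i * pdP p i g x

/-- The slice operator `D_ω = D_{𝐱_p} + ω ∂_r`, expressed on `ℝ^{p+q+1} ∖ ℝ^{p+1}`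
(at `𝐱_q = 0` the radial part is junk `0`). -/
def Dslice (f : V p q → A) : V p q → A :=
  fun z => ∑ i, εp p q ξ i * pdV1 p q i f z
    + ωCl p q ξ (‖z.2‖⁻¹ • z.2) * fderiv ℝ f z (0, ‖z.2‖⁻¹ • z.2)

/-- The spherical Dirac operator `Γ = -∑_{i<j} e_i e_j L_{ij}` on the `ℝ^q` variables. -/
def sphericalDirac (f : V p q → A) : V p q → A :=
  fun z => - ∑ i : Fin q, ∑ j : Fin q,
    if (i : ℕ) < (j : ℕ) then
      eQ p q ξ i * eQ p q ξ j *
        (z.2 i • pdV2 p q j f z - z.2 j • pdV2 p q i f z)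
    else 0

/-- `f` is left generalized partial-slice monogenic of type `(p,q)` on `Ω`. -/
def GSMOn (Ω : Set (V p q)) (f : V p q → A) : Prop :=
  ∀ v ∈ S q,
    ContDiffOn ℝ 1 (fun z => f (spt p q v z)) (sliceSet p q Ω v) ∧
    ∀ z ∈ sliceSet p q Ω v,
      DP p q ξ (fun w => f (spt p q v w)) z
        + ωCl p q ξ v * pdr p (fun w => f (spt p q v w)) z = 0

/-- `f` is (left) monogenic on `Ω`. -/
def MonogenicOn (Ω : Set (V p q)) (f : V p q → A) : Prop :=
  ContDiffOn ℝ 1 f Ω ∧ ∀ z ∈ Ω, DV p q ξ f z = 0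

/-- `f` is the generalized partial-slice function on `Ω_D` with components `F1, F2`
(an even–odd pair in the last variable). -/
def IsGPSlice (D : Set (Sl p)) (f : V p q → A) (F1 F2 : Sl p → A) : Prop :=
  (∀ z ∈ D, F1 (z.1, -z.2) = F1 z ∧ F2 (z.1, -z.2) = -F2 z) ∧
  ∀ z ∈ D, ∀ v ∈ S q, f (spt p q v z) = F1 z + ωCl p q ξ v * F2 z

/-- The generalized Cauchy–Riemann system (2.6) for the pair `(F1, F2)`. -/
def CRSystem (D : Set (Sl p)) (F1 F2 : Sl p → A) : Prop :=
  ∀ z ∈ D, DP p q ξ F1 z - pdr p F2 z = 0 ∧ DPbar p q ξ F2 z + pdr p F1 z = 0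

/-- `f ∈ 𝒢𝒮ℛ(Ω_D)` with the given components. -/
def GSROnWith (D : Set (Sl p)) (f : V p q → A) (F1 F2 : Sl p → A) : Prop :=
  IsGPSlice p q ξ D f F1 F2 ∧ ContDiffOn ℝ 1 F1 D ∧ ContDiffOn ℝ 1 F2 D ∧
    CRSystem p q ξ D F1 F2

/-- `f ∈ 𝒢𝒮ℛ(Ω_D)`. -/
def GSROn (D : Set (Sl p)) (f : V p q → A) : Prop :=
  ∃ F1 F2, GSROnWith p q ξ D f F1 F2

/-- Iterates `((1/r) ∂_r)^k F`. -/
def AIter (F : Sl p → A) : ℕ → Sl p → A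
  | 0 => F
  | k + 1 => fun z => z.2⁻¹ • pdr p (AIter F k) z

/-- Iterates `(∂_r (1/r))^k F`. -/
def BIter (F : Sl p → A) : ℕ → Sl p → A
  | 0 => F
  | k + 1 => fun z => fderiv ℝ (fun w : Sl p => w.2⁻¹ • BIter F k w) z (0, 1)

/-- `C_q(k) = (q-1)(q-3)⋯(q-2k+1)`. -/
def Cq (k : ℕ) : ℝ := ∏ j ∈ Finset.range k, ((q : ℝ) - (2 * (j : ℝ) + 1))

/-- The Fueter–Sce map `τ_q = (1/(q-1)!!) Δ^{(q-1)/2}` (for odd `q`). -/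
def tauq (f : V p q → A) : V p q → A :=
  fun z => (((q - 1)‼ : ℝ))⁻¹ • (LapV p q)^[(q - 1) / 2] f z

/-- `(𝐱_q D_{𝐱_p})^k`, for a fixed Clifford element `u` in place of `𝐱_q`. -/
def uDpow (u : A) : ℕ → (Vp p → A) → Vp p → A
  | 0 => fun g => g
  | k + 1 => fun g x => u * DPfun p q ξ (uDpow u k g) x

/-- The `k`-th term of the slice Cauchy–Kovalevskaya extension series. -/
def ckTerm (f₀ : Vp p → A) (k : ℕ) (z : V p q) : A :=
  ((k ! : ℝ))⁻¹ • uDpow p q ξ (ωCl p q ξ z.2) k f₀ z.1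

/-- The slice Cauchy–Kovalevskaya extension `CK[f₀]`. -/
def CKext (f₀ : Vp p → A) (z : V p q) : A := ∑' k, ckTerm p q ξ f₀ k z

/-- The `k`-th term of the CK-extension for a fixed direction `w`. -/
def ckDirTerm (w : Vq q) (f₀ : Vp p → A) (k : ℕ) (z : V p q) : A :=
  ((⟪w, z.2⟫) ^ k / (k ! : ℝ)) • uDpow p q ξ (ωCl p q ξ w) k f₀ z.1

/-- The CK-extension for a fixed direction `w ∈ 𝕊`. -/
def CKdir (w : Vq q) (f₀ : Vp p → A) (z : V p q) : A :=
  ∑' k, ckDirTerm p q ξ w f₀ k z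

/-- The coefficients of the generalized CK-extension:
`f_{2k} = (Γ(q/2) / (2^{2k} k! Γ(k+q/2))) Δ^k f₀` and
`f_{2k+1} = (Γ(q/2) / (2^{2k+1} k! Γ(k+q/2+1))) D Δ^k f₀`. -/
def gckCoeff (f₀ : Vp p → A) (k : ℕ) : Vp p → A :=
  if k % 2 = 0 then
    fun x => (Real.Gamma ((q : ℝ) / 2) /
        (2 ^ k * ((k / 2)! : ℝ) * Real.Gamma (((k / 2 : ℕ) : ℝ) + (q : ℝ) / 2))) •
      (LapP p)^[k / 2] f₀ x
  else
    fun x => (Real.Gamma ((q : ℝ) / 2) /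
        (2 ^ k * ((k / 2)! : ℝ) * Real.Gamma (((k / 2 : ℕ) : ℝ) + (q : ℝ) / 2 + 1))) •
      DPfun p q ξ ((LapP p)^[k / 2] f₀) x

/-- The `k`-th term `𝐱_q^k f_k(𝐱_p)` of the generalized CK-extension series. -/
def gckTerm (f₀ : Vp p → A) (k : ℕ) (z : V p q) : A :=
  (ωCl p q ξ z.2) ^ k * gckCoeff p q ξ f₀ k z.1

/-- The generalized CK-extension `GCK[f₀]`. -/
def GCKext (f₀ : Vp p → A) (z : V p q) : A := ∑' k, gckTerm p q ξ f₀ k z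

/-- The Radon transform `R[f](𝐱_p, r, ω) = ∫_{⟨𝐱_q,ω⟩=r} f(𝐱_p, 𝐱_q) dσ(𝐱_q)`. -/
def radon (f : V p q → A) (x : Vp p) (r : ℝ) (w : Vq q) : A :=
  ∫ u : ((Submodule.span ℝ {w})ᗮ : Submodule ℝ (Vq q)),
    f (x, r • w + (u : Vq q))

/-- The (suitably normalized) surface measure on the unit sphere of `ℝ^q`. -/
def sphMeasure : Measure (sphere (0 : Vq q) 1) := volume.toSphere

/-- The dual Radon transform
`Ř[f](𝐱_p, 𝐱_q) = (1/A_q) ∫_𝕊 f(𝐱_p, ⟨𝐱_q, η⟩ η) dS(η)` (a spherical average). -/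
def dualRadon (f : V p q → A) (z : V p q) : A :=
  ⨍ w : sphere (0 : Vq q) 1,
    f (z.1, (⟪((w : Vq q)), z.2⟫) • (w : Vq q)) ∂(sphMeasure q)

end GPS


namespace MonogenicContinuation

section Euclidean

variable {ι : Type*} [Fintype ι] {A : Type*} [NormedRing A] [NormedAlgebra ℝ A]

theorem fderiv_dilation (u : EuclideanSpace ℝ ι → A) (s : ℝ) (x y : EuclideanSpace ℝ ι) :
    fderiv ℝ (fun z => u (s • z)) x y = s • fderiv ℝ u (s • x) y := by
  rw [fderiv_comp_smul]; rfl

/-- A smooth radial weight supported in the closed unit ball. -/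
def weight (x : EuclideanSpace ℝ ι) : ℝ := expNegInvGlue (1 - ‖x‖ ^ 2)

theorem contDiff_weight : ContDiff ℝ 1 (weight : EuclideanSpace ℝ ι → ℝ) :=
  (expNegInvGlue.contDiff (n := 1)).comp (contDiff_const.sub (contDiff_norm_sq ℝ))

theorem weight_nonneg (x : EuclideanSpace ℝ ι) : 0 ≤ weight x := expNegInvGlue.nonneg _

theorem weight_eq_zero {x : EuclideanSpace ℝ ι} (hx : 1 ≤ ‖x‖) : weight x = 0 :=
  expNegInvGlue.zero_of_nonpos (by nlinarith)

theorem weight_pos {x : EuclideanSpace ℝ ι} (hx : ‖x‖ < 1) : 0 < weight x :=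
  expNegInvGlue.pos_of_pos (by nlinarith [norm_nonneg x])

theorem hasCompactSupport_weight :
    HasCompactSupport (weight : EuclideanSpace ℝ ι → ℝ) :=
  HasCompactSupport.intro (isCompact_closedBall 0 1) fun x hx =>
    weight_eq_zero (by simp at hx; exact hx.le)

variable [DecidableEq ι]

/-- The radial derivative of `u` at `x` equals minus the rotational operator
`∑ x_i τ_{ij} ∂_j` applied to `u`. -/
def RadialEq (τ : ι → ι → A) (u : EuclideanSpace ℝ ι → A) (x : EuclideanSpace ℝ ι) : Prop :=
  fderiv ℝ u x x =
    -∑ i, ∑ j, x i • (τ i j * fderiv ℝ u x (EuclideanSpace.single j 1))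

theorem RadialEq.dilation {τ : ι → ι → A} {u : EuclideanSpace ℝ ι → A} {s : ℝ}
    {x : EuclideanSpace ℝ ι} (h : RadialEq τ u (s • x)) :
    RadialEq τ (fun z => u (s • z)) x := by
  unfold RadialEq at *
  rw [fderiv_dilation, ← map_smul, h]
  congr 1
  refine Finset.sum_congr rfl fun i _ => Finset.sum_congr rfl fun j _ => ?_
  rw [fderiv_dilation, PiLp.smul_apply, smul_eq_mul, mul_smul_comm, smul_smul, mul_comm s]

theorem fderiv_weight (x : EuclideanSpace ℝ ι) :
    ∃ d : ℝ, ∀ j, fderiv ℝ weight x (EuclideanSpace.single j 1) = d * x j := by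
  have h1 : HasDerivAt expNegInvGlue (deriv expNegInvGlue (1 - ‖x‖ ^ 2)) (1 - ‖x‖ ^ 2) :=
    ((expNegInvGlue.contDiff (n := 1)).differentiable (by simp) _).hasDerivAt
  have h2 := h1.comp_hasFDerivAt x ((hasStrictFDerivAt_norm_sq x).hasFDerivAt.const_sub 1)
  refine ⟨-2 * deriv expNegInvGlue (1 - ‖x‖ ^ 2), fun j => ?_⟩
  have h3 : fderiv ℝ weight x = _ := h2.fderiv
  rw [h3]
  simp [EuclideanSpace.inner_single_right]
  ring

theorem integral_fderiv_eq_zero {E : Type*} [NormedAddCommGroup E] [NormedSpace ℝ E]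
    [FiniteDimensional ℝ E] [MeasurableSpace E] [BorelSpace E] {μ : Measure E}
    [μ.IsAddHaarMeasure] {Φ : E → ℝ} (hΦ : ContDiff ℝ 1 Φ) (hc : HasCompactSupport Φ) (a : E) :
    ∫ x, fderiv ℝ Φ x a ∂μ = 0 := by
  have hint : Integrable (fun x => fderiv ℝ Φ x a) μ :=
    ((hΦ.continuous_fderiv (by simp)).clm_apply continuous_const).integrable_of_hasCompactSupport
      (hc.fderiv_apply ℝ a)
  have := integral_mul_fderiv_eq_neg_fderiv_mul_of_integrable (μ := μ) (𝕜 := ℝ)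
    (f := fun _ : E => (1 : ℝ)) (g := Φ) (v := a) (by simp) (by simpa using hint)
    (by simpa using hΦ.continuous.integrable_of_hasCompactSupport hc)
    (by simp) (fun x _ => hΦ.differentiable (by simp) x)
  simpa using this

/-- The rotational operator is symmetric with respect to radial weights. -/
theorem integral_weight_radial_sub {τ : ι → ι → A} {B : A →L[ℝ] A →L[ℝ] ℝ}
    (hτ : ∀ i j, τ i j = -τ j i) (hB : ∀ i j a b, B (τ i j * a) b = -B a (τ i j * b))
    {u w : EuclideanSpace ℝ ι → A} (hu : ContDiff ℝ 1 u) (hw : ContDiff ℝ 1 w)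
    (hu' : ∀ x, ‖x‖ < 1 → RadialEq τ u x) (hw' : ∀ x, ‖x‖ < 1 → RadialEq τ w x) :
    ∫ x, weight x * (B (fderiv ℝ u x x) (w x) - B (u x) (fderiv ℝ w x x)) = 0 := by
  let Φ : ι → ι → EuclideanSpace ℝ ι → ℝ :=
    fun i j x => (weight x * x i) * B (u x) (τ i j * w x)
  have hcoord : ∀ i, ContDiff ℝ 1 (fun x : EuclideanSpace ℝ ι => x i) := fun i =>
    (EuclideanSpace.proj (𝕜 := ℝ) i).contDiff
  have hBB : ∀ i j, ContDiff ℝ 1 (fun x => B (u x) (τ i j * w x)) := fun i j =>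
    ((B.contDiff.comp hu).clm_apply (contDiff_const.mul hw))
  have hΦ : ∀ i j, ContDiff ℝ 1 (Φ i j) := fun i j =>
    (contDiff_weight.mul (hcoord i)).mul (hBB i j)
  have hΦc : ∀ i j, HasCompactSupport (Φ i j) := fun i j =>
    (hasCompactSupport_weight.mul_right).mul_right
  have hderiv : ∀ i j x, fderiv ℝ (Φ i j) x (EuclideanSpace.single j 1) =
      (fderiv ℝ weight x (EuclideanSpace.single j 1) * x i
        + weight x * (if i = j then 1 else 0)) * B (u x) (τ i j * w x)
      + weight x * x i * (B (fderiv ℝ u x (EuclideanSpace.single j 1)) (τ i j * w x)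
        + B (u x) (τ i j * fderiv ℝ w x (EuclideanSpace.single j 1))) := by
    intro i j x
    have d1 := (contDiff_weight.differentiable (by simp) x).hasFDerivAt (𝕜 := ℝ)
    have d2 : HasFDerivAt (fun x : EuclideanSpace ℝ ι => x i) _ x :=
      (EuclideanSpace.proj (𝕜 := ℝ) i).hasFDerivAt
    have d3 := (hu.differentiable (by simp) x).hasFDerivAt
    have d4 := (hw.differentiable (by simp) x).hasFDerivAt
    have d5 := (B.hasFDerivAt.comp x d3).clm_apply (d4.const_mul (τ i j))
    have d6 := (d1.mul d2).mul d5
    have : fderiv ℝ (Φ i j) x = _ := d6.fderiv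
    rw [this]
    have hij : (EuclideanSpace.single j (1:ℝ) : EuclideanSpace ℝ ι) i = if i = j then 1 else 0 := by
      simp
    simp [hij, -PiLp.single_apply]
    split_ifs <;> ring
  have hsum : ∀ x, weight x * (B (fderiv ℝ u x x) (w x) - B (u x) (fderiv ℝ w x x)) =
      ∑ i, ∑ j, fderiv ℝ (Φ i j) x (EuclideanSpace.single j 1) := by
    intro x
    obtain ⟨d, hd⟩ := fderiv_weight x
    have hdiag : ∀ i, B (u x) (τ i i * w x) = 0 := by
      intro i
      have := congrArg (fun t => B (u x) (t * w x)) (hτ i i)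
      simp only [neg_mul, map_neg] at this
      linarith
    have hanti : ∑ i, ∑ j, x i * x j * B (u x) (τ i j * w x) = 0 := by
      have h : ∑ i, ∑ j, x i * x j * B (u x) (τ i j * w x)
          = -∑ i, ∑ j, x i * x j * B (u x) (τ i j * w x) := by
        conv_lhs => rw [Finset.sum_comm]
        simp_rw [← Finset.sum_neg_distrib]
        refine Finset.sum_congr rfl fun i _ => Finset.sum_congr rfl fun j _ => ?_
        rw [hτ j i, neg_mul, map_neg]; ring
      linarith
    have hfirst : ∑ i, ∑ j, fderiv ℝ (Φ i j) x (EuclideanSpace.single j 1) =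
        d * (∑ i, ∑ j, x i * x j * B (u x) (τ i j * w x)) +
        weight x * ∑ i, ∑ j, x i * (-B (τ i j * fderiv ℝ u x (EuclideanSpace.single j 1)) (w x)
        + B (u x) (τ i j * fderiv ℝ w x (EuclideanSpace.single j 1))) := by
      simp_rw [Finset.mul_sum, ← Finset.sum_add_distrib]
      refine Finset.sum_congr rfl fun i _ => Finset.sum_congr rfl fun j _ => ?_
      rw [hderiv, hd, hB]
      by_cases hij : i = j
      · subst hij; rw [hdiag]; ring
      · rw [if_neg hij]; ring
    rw [hfirst, hanti, mul_zero, zero_add]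
    by_cases hx : ‖x‖ < 1
    · rw [hu' x hx, hw' x hx]
      simp [map_sum, mul_add, Finset.sum_add_distrib]
    · rw [weight_eq_zero (not_lt.mp hx), zero_mul, zero_mul]
  simp_rw [hsum]
  have hint : ∀ i j, Integrable
      (fun x => fderiv ℝ (Φ i j) x (EuclideanSpace.single j 1)) := fun i j =>
    (((hΦ i j).continuous_fderiv (by simp)).clm_apply
      continuous_const).integrable_of_hasCompactSupport ((hΦc i j).fderiv_apply ℝ _)
  rw [integral_finsetSum _ fun i _ => integrable_finsetSum _ fun j _ => hint i j]
  refine Finset.sum_eq_zero fun i _ => ?_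
  rw [integral_finsetSum _ fun j _ => hint i j]
  exact Finset.sum_eq_zero fun j _ => integral_fderiv_eq_zero (hΦ i j) (hΦc i j) _

theorem hasDerivAt_integral_of_isCompact {E : Type*} [TopologicalSpace E]
    [MeasurableSpace E] [BorelSpace E] [R1Space E] {μ : Measure E} [IsFiniteMeasureOnCompacts μ]
    {K K' : ℝ → E → ℝ} {k : Set E} (hk : IsCompact k) (hk' : IsClosed k)
    (hK : ∀ h, Continuous (K h)) (hK' : Continuous (Function.uncurry K'))
    (h0 : ∀ h, ∀ x ∉ k, K h x = 0) (h0' : ∀ h, ∀ x ∉ k, K' h x = 0)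
    (hd : ∀ h x, HasDerivAt (fun t => K t x) (K' h x) h) (t : ℝ) :
    HasDerivAt (fun s => ∫ x, K s x ∂μ) (∫ x, K' t x ∂μ) t := by
  have hint : ∀ {f : E → ℝ}, Continuous f → (∀ x ∉ k, f x = 0) → Integrable f μ := fun hf h =>
    hf.integrable_of_hasCompactSupport (HasCompactSupport.intro hk h)
  have hK't : Continuous (K' t) := hK'.comp (Continuous.prodMk_right t)
  obtain ⟨C, hC⟩ := ((isCompact_Icc (a := t - 1) (b := t + 1)).prod hk).exists_bound_of_continuousOn
    hK'.continuousOn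
  refine (hasDerivAt_integral_of_dominated_loc_of_deriv_le (bound := k.indicator fun _ => C)
    (Icc_mem_nhds (by linarith : t - 1 < t) (by linarith : t < t + 1))
    (Eventually.of_forall fun h => (hint (hK h) (h0 h)).aestronglyMeasurable)
    (hint (hK t) (h0 t)) (hint hK't (h0' t)).aestronglyMeasurable
    (Eventually.of_forall fun x s hs => ?_) ?_ (Eventually.of_forall fun x s _ => hd s x)).2
  · by_cases hx : x ∈ k
    · rw [Set.indicator_of_mem hx]
      exact hC (s, x) ⟨hs, hx⟩
    · rw [Set.indicator_of_notMem hx, h0' s x hx, norm_zero]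
  · exact (integrable_indicator_iff hk'.measurableSet).2
      (integrableOn_const hk.measure_lt_top.ne)

/-- For a solution `u` of the radial equation, `∫ weight(x) B(u(sx), u(tx)) dx` depends
only on the product `st`. -/
theorem hasDerivAt_integral_dilations {τ : ι → ι → A} {B : A →L[ℝ] A →L[ℝ] ℝ}
    (hτ : ∀ i j, τ i j = -τ j i) (hB : ∀ i j a b, B (τ i j * a) b = -B a (τ i j * b))
    {u : EuclideanSpace ℝ ι → A} (hu : ContDiff ℝ 1 u) {R : ℝ}
    (hu' : ∀ x, ‖x‖ < R → RadialEq τ u x) {ρ h : ℝ} (hρ : 0 < ρ)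
    (h1 : ρ * Real.exp h ≤ R) (h2 : ρ * Real.exp (-h) ≤ R) :
    HasDerivAt (fun t => ∫ x, weight x *
      B (u ((ρ * Real.exp t) • x)) (u ((ρ * Real.exp (-t)) • x))) 0 h := by
  have hdiff : Differentiable ℝ u := hu.differentiable (by simp)
  have hfd : Continuous (fderiv ℝ u) := hu.continuous_fderiv (by simp)
  have hradial : ∀ s : ℝ, 0 ≤ s → s ≤ R → ∀ x, ‖x‖ < 1 → RadialEq τ (fun z => u (s • z)) x := by
    intro s hs hsR x hx
    refine RadialEq.dilation (hu' _ ?_)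
    rw [norm_smul, Real.norm_of_nonneg hs]
    rcases hs.eq_or_lt with rfl | hs'
    · have : 0 < R := lt_of_lt_of_le (by positivity) h1
      simpa
    · nlinarith
  have hzero := integral_weight_radial_sub hτ hB
    (u := fun z => u ((ρ * Real.exp h) • z)) (w := fun z => u ((ρ * Real.exp (-h)) • z))
    (hu.comp (contDiff_const_smul _)) (hu.comp (contDiff_const_smul _))
    (hradial _ (by positivity) h1) (hradial _ (by positivity) h2)
  have hd : ∀ (σ : ℝ) (s : ℝ) x, HasDerivAt (fun t => u ((ρ * Real.exp (σ * t)) • x))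
      (σ • fderiv ℝ (fun z => u ((ρ * Real.exp (σ * s)) • z)) x x) s := by
    intro σ s x
    have hs : HasDerivAt (fun t => (ρ * Real.exp (σ * t)) • x)
        ((ρ * (Real.exp (σ * s) * (σ * 1))) • x) s :=
      ((((hasDerivAt_id s).const_mul σ).exp).const_mul ρ).smul_const x
    have := (hdiff ((ρ * Real.exp (σ * s)) • x)).hasFDerivAt.comp_hasDerivAt s hs
    refine this.congr_deriv ?_
    rw [fderiv_dilation, map_smul, smul_smul]
    congr 1
    ring
  have hcont : ∀ σ : ℝ, Continuous fun z : ℝ × EuclideanSpace ℝ ι =>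
      fderiv ℝ (fun y => u ((ρ * Real.exp (σ * z.1)) • y)) z.2 z.2 := by
    intro σ
    simp_rw [fderiv_dilation]
    fun_prop
  have hucont := hu.continuous
  rw [← hzero]
  have key := hasDerivAt_integral_of_isCompact
    (E := EuclideanSpace ℝ ι) (μ := volume)
    (K := fun t x => weight x * B (u ((ρ * Real.exp (1 * t)) • x)) (u ((ρ * Real.exp (-1 * t)) • x)))
    (K' := fun t x => weight x *
      (B ((1 : ℝ) • fderiv ℝ (fun z => u ((ρ * Real.exp (1 * t)) • z)) x x)
          (u ((ρ * Real.exp (-1 * t)) • x))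
        + B (u ((ρ * Real.exp (1 * t)) • x))
          ((-1 : ℝ) • fderiv ℝ (fun z => u ((ρ * Real.exp (-1 * t)) • z)) x x)))
    (isCompact_closedBall 0 1) isClosed_closedBall ?_ ?_ ?_ ?_ ?_ h
  · simpa [sub_eq_add_neg] using key
  · intro t
    have := (contDiff_weight (ι := ι)).continuous
    fun_prop
  · have := (contDiff_weight (ι := ι)).continuous
    have c1 := hcont 1
    have c2 := hcont (-1)
    simp only [Function.uncurry_def]
    fun_prop
  · intro t x hx
    rw [weight_eq_zero (by simp at hx; exact hx.le), zero_mul]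
  · intro t x hx
    rw [weight_eq_zero (by simp at hx; exact hx.le), zero_mul]
  · intro t x
    have := ((B.hasFDerivAt.comp_hasDerivAt t (hd 1 t x)).clm_apply (hd (-1) t x)).const_mul (weight x)
    exact this

/-- Solutions of the radial equation vanishing near the origin vanish on larger balls. -/
theorem eq_zero_of_radialEq_step {τ : ι → ι → A} {B : A →L[ℝ] A →L[ℝ] ℝ}
    (hτ : ∀ i j, τ i j = -τ j i) (hB : ∀ i j a b, B (τ i j * a) b = -B a (τ i j * b))
    (hpos : ∀ a, 0 ≤ B a a)
    {u : EuclideanSpace ℝ ι → A} (hu : ContDiff ℝ 1 u) {R : ℝ}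
    (hu' : ∀ x, ‖x‖ < R → RadialEq τ u x) {a ρ : ℝ} (ha : 0 < a) (haρ : a ≤ ρ)
    (hρR : ρ ^ 2 ≤ a * R) (hzero : ∀ x, ‖x‖ < a → u x = 0) {x : EuclideanSpace ℝ ι}
    (hx : ‖x‖ < ρ) : B (u x) (u x) = 0 := by
  have hρ : 0 < ρ := ha.trans_le haρ
  set h₁ := Real.log (ρ / a) with hh₁
  have he : Real.exp h₁ = ρ / a := Real.exp_log (by positivity)
  have he' : Real.exp (-h₁) = a / ρ := by rw [Real.exp_neg, he, inv_div]
  have hh₁0 : 0 ≤ h₁ := Real.log_nonneg ((one_le_div ha).2 haρ)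
  have htop : ρ * (ρ / a) ≤ R := by
    rw [← mul_div_assoc, div_le_iff₀ ha]
    nlinarith
  have hρR' : ρ ≤ R := by
    refine le_trans ?_ htop
    rw [le_mul_iff_one_le_right hρ]
    exact (one_le_div ha).2 haρ
  set H : ℝ → ℝ := fun t => ∫ x, weight x *
      B (u ((ρ * Real.exp t) • x)) (u ((ρ * Real.exp (-t)) • x)) with hH
  have hderiv : ∀ t ∈ Set.Icc 0 h₁, HasDerivAt H 0 t := fun t ht => by
    refine hasDerivAt_integral_dilations hτ hB hu hu' hρ ?_ ?_
    · exact (mul_le_mul_of_nonneg_left ((Real.exp_le_exp.2 ht.2).trans_eq he) hρ.le).trans htop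
    · exact (mul_le_of_le_one_right hρ.le (Real.exp_le_one_iff.2 (by linarith [ht.1]))).trans hρR'
  have hconst : H h₁ = H 0 :=
    constant_of_has_deriv_right_zero (fun t ht => (hderiv t ht).continuousAt.continuousWithinAt)
      (fun t ht => (hderiv t ⟨ht.1, ht.2.le⟩).hasDerivWithinAt) h₁ ⟨hh₁0, le_rfl⟩
  have hH₁ : H h₁ = 0 := by
    rw [hH]
    refine integral_eq_zero_of_ae (Eventually.of_forall fun y => ?_)
    change weight y * B _ _ = 0
    by_cases hy : ‖y‖ < 1
    · rw [hzero ((ρ * Real.exp (-h₁)) • y), map_zero, mul_zero]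
      rw [he', mul_div_cancel₀ _ hρ.ne', norm_smul, Real.norm_of_nonneg ha.le]
      nlinarith
    · rw [weight_eq_zero (not_lt.1 hy), zero_mul]
  by_contra hne
  have hcont : Continuous fun y : EuclideanSpace ℝ ι => weight y * B (u (ρ • y)) (u (ρ • y)) := by
    have := (contDiff_weight (ι := ι)).continuous
    have := hu.continuous
    fun_prop
  have hpos' := hcont.integral_pos_of_hasCompactSupport_nonneg_nonzero (μ := volume)
    (x := ρ⁻¹ • x) hasCompactSupport_weight.mul_right
    (fun y => mul_nonneg (weight_nonneg y) (hpos _)) (by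
      rw [smul_inv_smul₀ hρ.ne']
      refine mul_ne_zero (weight_pos ?_).ne' hne
      rw [norm_smul, norm_inv, Real.norm_of_nonneg hρ.le, inv_mul_lt_iff₀ hρ, mul_one]
      exact hx)
  have : H 0 = ∫ y, weight y * B (u (ρ • y)) (u (ρ • y)) := by simp [hH]
  linarith

/-- Solutions of the radial equation on a ball vanishing near its centre vanish on the ball. -/
theorem eq_zero_of_radialEq {τ : ι → ι → A} (hτ : ∀ i j, τ i j = -τ j i)
    (hB : ∀ ℓ : A →L[ℝ] ℝ, ∃ B : A →L[ℝ] A →L[ℝ] ℝ,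
      (∀ i j a b, B (τ i j * a) b = -B a (τ i j * b)) ∧ ∀ a, (ℓ a) ^ 2 ≤ B a a)
    {u : EuclideanSpace ℝ ι → A} (hu : ContDiff ℝ 1 u) {R : ℝ}
    (hu' : ∀ x, ‖x‖ < R → RadialEq τ u x) {a : ℝ} (ha : 0 < a)
    (hzero : ∀ x, ‖x‖ < a → u x = 0) {x : EuclideanSpace ℝ ι} (hx : ‖x‖ < R) : u x = 0 := by
  have hstep : ∀ b ρ, 0 < b → b ≤ ρ → ρ ^ 2 ≤ b * R → (∀ y, ‖y‖ < b → u y = 0) →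
      ∀ y, ‖y‖ < ρ → u y = 0 := by
    intro b ρ hb hbρ hρ hz y hy
    refine SeparatingDual.eq_zero_of_forall_dual_eq_zero (R := ℝ) fun ℓ => ?_
    obtain ⟨B, hB1, hB2⟩ := hB ℓ
    have := eq_zero_of_radialEq_step hτ hB1 (fun a => (sq_nonneg _).trans (hB2 a)) hu hu' hb hbρ
      hρ hz hy
    have h2 := hB2 (u y)
    rw [this] at h2
    exact pow_eq_zero_iff two_ne_zero |>.1 (le_antisymm h2 (sq_nonneg _))
  rcases lt_or_ge ‖x‖ a with hxa | hxa
  · exact hzero x hxa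
  let T : Set ℝ := {b | a ≤ b ∧ b ≤ R ∧ ∀ y, ‖y‖ < b → u y = 0}
  have haT : a ∈ T := ⟨le_rfl, (hxa.trans_lt hx).le, hzero⟩
  have hbdd : BddAbove T := ⟨R, fun b hb => hb.2.1⟩
  set s := sSup T
  have has : a ≤ s := le_csSup hbdd haT
  have hsz : ∀ y, ‖y‖ < s → u y = 0 := fun y hy => by
    obtain ⟨b, hb, hyb⟩ := exists_lt_of_lt_csSup ⟨a, haT⟩ hy
    exact hb.2.2 y hyb
  have hsR : s ≤ R := csSup_le ⟨a, haT⟩ fun b hb => hb.2.1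
  rcases hsR.eq_or_lt with hsR' | hsR'
  · exact hsz x (hsR' ▸ hx)
  · have hs0 : 0 < s := ha.trans_le has
    have hlt : s < √(s * R) := Real.lt_sqrt_of_sq_lt (by nlinarith)
    have hsq : √(s * R) ^ 2 = s * R := Real.sq_sqrt (by nlinarith)
    have hmem : √(s * R) ∈ T := by
      refine ⟨has.trans hlt.le, ?_, hstep s _ hs0 hlt.le hsq.le hsz⟩
      exact Real.sqrt_le_iff.2 ⟨by linarith, by nlinarith⟩
    exact absurd (le_csSup hbdd hmem) (not_le.2 hlt)

/-- The generalized Cauchy–Riemann (Dirac) operator `∑ σ_i ∂_i`. -/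
def dirac (σ : ι → A) (u : EuclideanSpace ℝ ι → A) (x : EuclideanSpace ℝ ι) : A :=
  ∑ i, σ i * fderiv ℝ u x (EuclideanSpace.single i 1)

theorem clm_apply_eq_sum (L : EuclideanSpace ℝ ι →L[ℝ] A) (x : EuclideanSpace ℝ ι) :
    L x = ∑ i, x i • L (EuclideanSpace.single i 1) := by
  conv_lhs => rw [← (EuclideanSpace.basisFun ι ℝ).sum_repr x]
  simp

theorem radialEq_of_dirac_eq_zero {σ σ' : ι → A} {τ : ι → ι → A}
    (hσ : ∀ i j, σ' i * σ j = (if i = j then 1 else 0) + τ i j)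
    {u : EuclideanSpace ℝ ι → A} {x : EuclideanSpace ℝ ι} (h : dirac σ u x = 0) :
    RadialEq τ u x := by
  have h0 : ∑ i, x i • (σ' i * dirac σ u x) = 0 := by simp [h]
  unfold dirac at h0
  simp_rw [Finset.mul_sum, ← mul_assoc, hσ, add_mul, Finset.sum_add_distrib, smul_add,
    Finset.sum_add_distrib, Finset.smul_sum] at h0
  unfold RadialEq
  rw [clm_apply_eq_sum, ← add_eq_zero_iff_eq_neg]
  simpa using h0

theorem eqOn_zero_of_dirac {σ σ' : ι → A} {τ : ι → ι → A} (hτ : ∀ i j, τ i j = -τ j i)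
    (hσ : ∀ i j, σ' i * σ j = (if i = j then 1 else 0) + τ i j)
    (hB : ∀ ℓ : A →L[ℝ] ℝ, ∃ B : A →L[ℝ] A →L[ℝ] ℝ,
      (∀ i j a b, B (τ i j * a) b = -B a (τ i j * b)) ∧ ∀ a, (ℓ a) ^ 2 ≤ B a a)
    {U : Set (EuclideanSpace ℝ ι)} (hU : IsOpen U) (hUc : IsPreconnected U)
    {F : EuclideanSpace ℝ ι → A} (hF : ContDiffOn ℝ 1 F U) (hD : ∀ x ∈ U, dirac σ F x = 0)
    {x₀ : EuclideanSpace ℝ ι} (hx₀ : x₀ ∈ U) (hzero : F =ᶠ[𝓝 x₀] 0) :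
    ∀ x ∈ U, F x = 0 := by
  suffices h : U ⊆ {x | F =ᶠ[𝓝 x] 0} from fun x hx => (h hx).self_of_nhds
  refine hUc.subset_of_closure_inter_subset isOpen_setOfPred_eventually_nhds ⟨x₀, hx₀, hzero⟩ ?_
  rintro x ⟨hxc, hxU⟩
  obtain ⟨ε, hε, hεU⟩ := Metric.isOpen_iff.1 hU x hxU
  obtain ⟨y, hy, hxy⟩ := Metric.mem_closure_iff.1 hxc (ε / 4) (by positivity)
  let χ : ContDiffBump y := ⟨ε / 4, ε / 2, by positivity, by linarith⟩
  have hsub : closedBall y (ε / 2) ⊆ U := fun z hz => hεU <| by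
    rw [mem_closedBall] at hz
    rw [mem_ball]
    linarith [dist_triangle z y x, dist_comm x y]
  have hG : ContDiff ℝ 1 fun z => χ z • F z := by
    rw [contDiff_iff_contDiffAt]
    intro z
    by_cases hz : z ∈ U
    · exact χ.contDiff.contDiffAt.smul (hF.contDiffAt (hU.mem_nhds hz))
    · have hz' : z ∉ tsupport χ := by
        rw [χ.tsupport_eq]
        exact fun h => hz (hsub h)
      refine (contDiffAt_const (c := (0 : A))).congr_of_eventuallyEq ?_
      filter_upwards [notMem_tsupport_iff_eventuallyEq.1 hz'] with w hw
      simp [hw]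
  have hGF : ∀ z ∈ ball y (ε / 4), (fun z => χ z • F z) =ᶠ[𝓝 z] F := fun z hz => by
    filter_upwards [isOpen_ball.mem_nhds hz] with w hw
    rw [χ.one_of_mem_closedBall (ball_subset_closedBall hw), one_smul]
  let u : EuclideanSpace ℝ ι → A := fun z => χ (y + z) • F (y + z)
  have hball : ∀ z : EuclideanSpace ℝ ι, ‖z‖ < ε / 4 → y + z ∈ ball y (ε / 4) := fun z hz => by
    simpa [mem_ball, dist_eq_norm] using hz
  have hu : ContDiff ℝ 1 u := hG.comp (contDiff_const.add contDiff_id)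
  have hu' : ∀ z, ‖z‖ < ε / 4 → RadialEq τ u z := fun z hz => by
    refine radialEq_of_dirac_eq_zero hσ ?_
    have h1 : fderiv ℝ u z = fderiv ℝ F (y + z) :=
      (fderiv_comp_add_left (f := fun z => χ z • F z) y).trans (hGF _ (hball z hz)).fderiv_eq
    unfold dirac
    rw [h1]
    exact hD _ (hsub (closedBall_subset_closedBall (by linarith)
      (ball_subset_closedBall (hball z hz))))
  obtain ⟨a, ha, haF⟩ := Metric.eventually_nhds_iff.1 (show F =ᶠ[𝓝 y] 0 from hy)
  have huzero : ∀ z, ‖z‖ < a → u z = 0 := fun z hz => by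
    have : F (y + z) = 0 := haF (by simpa [dist_eq_norm] using hz)
    simp [u, this]
  filter_upwards [isOpen_ball.mem_nhds (show x ∈ ball y (ε / 4) from hxy)] with z hz
  have h2 : u (z - y) = 0 :=
    eq_zero_of_radialEq hτ hB hu hu' ha huzero (by simpa [dist_eq_norm] using hz)
  rw [← (hGF z hz).self_of_nhds]
  simpa [u] using h2

theorem sum_mul_sum_eq_norm_sq {σ σ' : ι → A} {τ : ι → ι → A} (hτ : ∀ i j, τ i j = -τ j i)
    (hσ : ∀ i j, σ' i * σ j = (if i = j then 1 else 0) + τ i j) (n : EuclideanSpace ℝ ι) :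
    (∑ i, n i • σ' i) * (∑ j, n j • σ j) = (‖n‖ ^ 2) • (1 : A) := by
  have hanti : ∑ i, ∑ j, (n i * n j) • τ i j = 0 := by
    have h : ∑ i, ∑ j, (n i * n j) • τ i j = -∑ i, ∑ j, (n i * n j) • τ i j := by
      conv_lhs => rw [Finset.sum_comm]
      simp_rw [← Finset.sum_neg_distrib]
      refine Finset.sum_congr rfl fun i _ => Finset.sum_congr rfl fun j _ => ?_
      rw [hτ j i, smul_neg, mul_comm]
    have h2 : (2 : ℝ) • ∑ i, ∑ j, (n i * n j) • τ i j = 0 := by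
      rw [two_smul]
      nth_rewrite 1 [h]
      exact neg_add_cancel _
    exact (smul_eq_zero.1 h2).resolve_left two_ne_zero
  simp_rw [Finset.sum_mul_sum, smul_mul_smul_comm, hσ, smul_add, Finset.sum_add_distrib, hanti,
    add_zero, EuclideanSpace.norm_sq_eq, Finset.sum_smul]
  simp [pow_two]

/-- A covector vanishing on a hyperplane and annihilated by the Dirac symbol is zero. -/
theorem clm_eq_zero_of_hyperplane {σ σ' : ι → A} {τ : ι → ι → A} (hτ : ∀ i j, τ i j = -τ j i)
    (hσ : ∀ i j, σ' i * σ j = (if i = j then 1 else 0) + τ i j)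
    {R : Submodule ℝ (EuclideanSpace ℝ ι)} (hR : Module.finrank ℝ R + 1 = Fintype.card ι)
    {L : EuclideanSpace ℝ ι →L[ℝ] A} (hL : ∀ x ∈ R, L x = 0)
    (hσL : ∑ i, σ i * L (EuclideanSpace.single i 1) = 0) : L = 0 := by
  have hrank : Module.finrank ℝ Rᗮ = 1 := by
    have := R.finrank_add_finrank_orthogonal
    rw [finrank_euclideanSpace] at this
    omega
  obtain ⟨⟨n, hn⟩, hn0, hspan⟩ := finrank_eq_one_iff'.1 hrank
  have hn0' : n ≠ 0 := fun h => hn0 (Subtype.ext h)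
  have hnn : ‖n‖ ^ 2 ≠ 0 := by simpa using hn0'
  have hLx : ∀ x, (‖n‖ ^ 2) • L x = ⟪n, x⟫ • L n := by
    intro x
    obtain ⟨y, hy, z, hz, rfl⟩ := R.exists_add_mem_mem_orthogonal x
    obtain ⟨c, hc⟩ := hspan ⟨z, hz⟩
    have hc' : c • n = z := congrArg Subtype.val hc
    have hny : ⟪n, y⟫ = 0 := (R.mem_orthogonal' n).1 hn y hy
    rw [map_add, hL y hy, zero_add, ← hc', map_smul, inner_add_right, hny, zero_add,
      real_inner_smul_right, real_inner_self_eq_norm_sq, smul_smul, mul_comm]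
  have hLn : L n = 0 := by
    have h1 : (∑ i, n i • σ i) * L n = 0 := by
      have := congrArg (fun a => (‖n‖ ^ 2) • a) hσL
      simp only [smul_zero, Finset.smul_sum, ← mul_smul_comm, hLx] at this
      simpa [EuclideanSpace.inner_single_right, Finset.sum_mul] using this
    have h2 := congrArg (fun a => (∑ i, n i • σ' i) * a) h1
    simp only [← mul_assoc, sum_mul_sum_eq_norm_sq hτ hσ, mul_zero, smul_mul_assoc, one_mul] at h2
    exact (smul_eq_zero.1 h2).resolve_left hnn
  ext x
  have := hLx x
  rw [hLn, smul_zero] at this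
  exact (smul_eq_zero.1 this).resolve_left hnn

theorem continuousOn_indicator_of_eq_zero {X Y : Type*} [TopologicalSpace X]
    [NormedAddCommGroup Y] {P N U : Set X} {f : X → Y} (hP : IsOpen P) (hN : IsOpen N)
    (hPN : Disjoint P N) (hU : ∀ x ∈ U, x ∈ P ∨ x ∈ N ∨ f x = 0) (hf : ContinuousOn f U) :
    ContinuousOn (P.indicator f) U := by
  intro x hx
  by_cases hxP : x ∈ P
  · refine (hf x hx).congr_of_eventuallyEq ?_ (Set.indicator_of_mem hxP f)
    filter_upwards [mem_nhdsWithin_of_mem_nhds (hP.mem_nhds hxP)] with y hy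
    exact Set.indicator_of_mem hy f
  rcases (hU x hx).resolve_left hxP with hxN | hfx
  · refine (continuousWithinAt_const (b := (0 : Y))).congr_of_eventuallyEq ?_
      (Set.indicator_of_notMem hxP f)
    filter_upwards [mem_nhdsWithin_of_mem_nhds (hN.mem_nhds hxN)] with y hy
    exact Set.indicator_of_notMem (hPN.notMem_of_mem_right hy) f
  · have h := hf x hx
    rw [ContinuousWithinAt, hfx] at h
    rw [ContinuousWithinAt, Set.indicator_of_notMem hxP]
    exact squeeze_zero_norm (fun y => norm_indicator_le_norm_self f y) (by simpa using h.norm)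

theorem hasFDerivAt_indicator_of_eq_zero {X Y : Type*} [NormedAddCommGroup X] [NormedSpace ℝ X]
    [NormedAddCommGroup Y] [NormedSpace ℝ Y] {P N : Set X} {f : X → Y} (hP : IsOpen P)
    (hN : IsOpen N) (hPN : Disjoint P N) {x : X} (hf : DifferentiableAt ℝ f x)
    (hx : x ∈ P ∨ x ∈ N ∨ f x = 0 ∧ fderiv ℝ f x = 0) :
    HasFDerivAt (P.indicator f) (P.indicator (fderiv ℝ f) x) x := by
  by_cases hxP : x ∈ P
  · rw [Set.indicator_of_mem hxP]
    refine hf.hasFDerivAt.congr_of_eventuallyEq ?_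
    filter_upwards [hP.mem_nhds hxP] with y hy
    exact Set.indicator_of_mem hy f
  rw [Set.indicator_of_notMem hxP]
  rcases hx.resolve_left hxP with hxN | ⟨hfx, hdfx⟩
  · refine (hasFDerivAt_const (0 : Y) x).congr_of_eventuallyEq ?_
    filter_upwards [hN.mem_nhds hxN] with y hy
    exact Set.indicator_of_notMem (hPN.notMem_of_mem_right hy) f
  · have h := hf.hasFDerivAt
    rw [hdfx, hasFDerivAt_iff_isLittleO] at h
    rw [hasFDerivAt_iff_isLittleO]
    refine Asymptotics.IsBigO.trans_isLittleO (Asymptotics.IsBigO.of_bound 1 ?_) h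
    refine Eventually.of_forall fun y => ?_
    simpa [Set.indicator_of_notMem hxP, hfx] using norm_indicator_le_norm_self f y

/-- **Unique continuation across a hypersurface**: a `C¹` solution of `∑ σ_i ∂_i F = 0` on a
connected open set vanishing on an immersed patch of codimension one vanishes identically. -/
theorem eqOn_zero_of_dirac_of_hypersurface {σ σ' : ι → A} {τ : ι → ι → A}
    (hτ : ∀ i j, τ i j = -τ j i)
    (hσ : ∀ i j, σ' i * σ j = (if i = j then 1 else 0) + τ i j)
    (hB : ∀ ℓ : A →L[ℝ] ℝ, ∃ B : A →L[ℝ] A →L[ℝ] ℝ,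
      (∀ i j a b, B (τ i j * a) b = -B a (τ i j * b)) ∧ ∀ a, (ℓ a) ^ 2 ≤ B a a)
    {U : Set (EuclideanSpace ℝ ι)} (hU : IsOpen U) (hUc : IsPreconnected U)
    {F : EuclideanSpace ℝ ι → A} (hF : ContDiffOn ℝ 1 F U) (hD : ∀ x ∈ U, dirac σ F x = 0)
    {X : Type*} [NormedAddCommGroup X] [NormedSpace ℝ X] [FiniteDimensional ℝ X]
    (hX : Module.finrank ℝ X + 1 = Fintype.card ι)
    {ψ : X → EuclideanSpace ℝ ι} {W : Set X} (hW : IsOpen W) (hψ : ContDiffOn ℝ 1 ψ W)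
    (hψ' : ∀ y ∈ W, Function.Injective (fderiv ℝ ψ y)) (hψU : ∀ y ∈ W, ψ y ∈ U)
    (hFψ : ∀ y ∈ W, F (ψ y) = 0) {y₀ : X} (hy₀ : y₀ ∈ W) :
    ∀ x ∈ U, F x = 0 := by
  have hFdiff : ∀ x ∈ U, DifferentiableAt ℝ F x := fun x hx =>
    (hF.contDiffAt (hU.mem_nhds hx)).differentiableAt (by simp)
  have hψdiff : ∀ y ∈ W, DifferentiableAt ℝ ψ y := fun y hy =>
    (hψ.contDiffAt (hW.mem_nhds hy)).differentiableAt (by simp)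
  have hrank : ∀ y ∈ W, Module.finrank ℝ (LinearMap.range (fderiv ℝ ψ y).toLinearMap) + 1 =
      Fintype.card ι := fun y hy => by
    rw [LinearMap.finrank_range_of_inj (hψ' y hy), hX]
  have hdF : ∀ y ∈ W, fderiv ℝ F (ψ y) = 0 := fun y hy => by
    refine clm_eq_zero_of_hyperplane hτ hσ (hrank y hy) ?_ (hD _ (hψU y hy))
    rintro _ ⟨a, rfl⟩
    have h1 := (hFdiff _ (hψU y hy)).hasFDerivAt.comp y (hψdiff y hy).hasFDerivAt
    have h2 : HasFDerivAt (F ∘ ψ) (0 : X →L[ℝ] A) y :=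
      (hasFDerivAt_const (0 : A) y).congr_of_eventuallyEq <| by
        filter_upwards [hW.mem_nhds hy] with z hz using hFψ z hz
    exact DFunLike.congr_fun (h1.unique h2) a
  obtain ⟨n, hn, hn0⟩ : ∃ n ∈ (LinearMap.range (fderiv ℝ ψ y₀).toLinearMap)ᗮ, n ≠ 0 := by
    refine Submodule.exists_mem_ne_zero_of_ne_bot fun h => ?_
    have h1 := hrank y₀ hy₀
    have h2 := (LinearMap.range (fderiv ℝ ψ y₀).toLinearMap).finrank_add_finrank_orthogonal
    rw [h, finrank_bot, finrank_euclideanSpace] at h2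
    omega
  let T : X × ℝ →L[ℝ] EuclideanSpace ℝ ι :=
    fderiv ℝ ψ y₀ ∘L ContinuousLinearMap.fst ℝ X ℝ + (ContinuousLinearMap.snd ℝ X ℝ).smulRight n
  have hT : Function.Injective T := by
    refine (injective_iff_map_eq_zero T).2 ?_
    rintro ⟨a, t⟩ hat
    have hat' : fderiv ℝ ψ y₀ a + t • n = 0 := by simpa [T] using hat
    have h1 : ⟪fderiv ℝ ψ y₀ a, n⟫ = 0 := (Submodule.mem_orthogonal _ _).1 hn _ ⟨a, rfl⟩
    have h2 : ⟪fderiv ℝ ψ y₀ a + t • n, n⟫ = 0 := by rw [hat', inner_zero_left]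
    rw [inner_add_left, h1, zero_add, real_inner_smul_left, real_inner_self_eq_norm_sq] at h2
    have ht : t = 0 := (mul_eq_zero.1 h2).resolve_right (by simpa using hn0)
    rw [ht, zero_smul, add_zero] at hat'
    rw [hψ' y₀ hy₀ (hat'.trans (map_zero _).symm), ht]
    rfl
  let T' : (X × ℝ) ≃L[ℝ] EuclideanSpace ℝ ι :=
    (LinearMap.linearEquivOfInjective T.toLinearMap hT (by simp [hX])).toContinuousLinearEquiv
  have hTT' : (T' : X × ℝ →L[ℝ] EuclideanSpace ℝ ι) = T := by ext <;> rfl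
  let Ψ : X × ℝ → EuclideanSpace ℝ ι := fun z => ψ z.1 + z.2 • n
  have hΨ : HasStrictFDerivAt Ψ (T' : X × ℝ →L[ℝ] EuclideanSpace ℝ ι) (y₀, 0) := by
    have h1 : HasStrictFDerivAt ψ (fderiv ℝ ψ y₀) y₀ :=
      (hψ.contDiffAt (hW.mem_nhds hy₀)).hasStrictFDerivAt (by simp)
    have h2 : HasStrictFDerivAt (fun z : X × ℝ => z.2) (ContinuousLinearMap.snd ℝ X ℝ)
        (y₀, (0 : ℝ)) := hasStrictFDerivAt_snd
    have h3 := (HasStrictFDerivAt.comp (y₀, (0 : ℝ)) h1 hasStrictFDerivAt_fst).add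
      (h2.smul_const n)
    rw [hTT']
    exact h3
  let e := hΨ.toOpenPartialHomeomorph Ψ
  have he : ∀ z, e z = Ψ z := fun _ => rfl
  have hsrc : (y₀, (0 : ℝ)) ∈ e.source := hΨ.mem_toOpenPartialHomeomorph_source
  have hnhds : e.source ∩ ((fun z : X × ℝ => z.1) ⁻¹' W) ∩ Ψ ⁻¹' U ∈ 𝓝 (y₀, (0 : ℝ)) := by
    refine inter_mem (inter_mem (e.open_source.mem_nhds hsrc)
      (continuous_fst.continuousAt.preimage_mem_nhds (hW.mem_nhds hy₀)))
      (hΨ.continuousAt.preimage_mem_nhds (hU.mem_nhds ?_))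
    simpa [Ψ] using hψU y₀ hy₀
  obtain ⟨ε, hε, hεsub⟩ := Metric.mem_nhds_iff.1 hnhds
  set O := ball (y₀, (0 : ℝ)) ε with hO
  have hOsrc : O ⊆ e.source := fun z hz => (hεsub hz).1.1
  have hopen : ∀ {s : Set (X × ℝ)}, IsOpen s → s ⊆ O → IsOpen (Ψ '' s) := fun hs hsO =>
    e.isOpen_image_of_subset_source hs (hsO.trans hOsrc)
  have hinj : Set.InjOn Ψ O := e.injOn.mono hOsrc
  have hOpos : IsOpen (O ∩ {z | 0 < z.2}) :=
    isOpen_ball.inter (isOpen_lt continuous_const continuous_snd)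
  have hOneg : IsOpen (O ∩ {z | z.2 < 0}) :=
    isOpen_ball.inter (isOpen_lt continuous_snd continuous_const)
  set P := Ψ '' (O ∩ {z | 0 < z.2})
  set N := Ψ '' (O ∩ {z | z.2 < 0})
  have hP : IsOpen P := hopen hOpos Set.inter_subset_left
  have hN : IsOpen N := hopen hOneg Set.inter_subset_left
  have hPN : Disjoint P N := by
    rw [Set.disjoint_left]
    rintro _ ⟨a, ⟨haO, ha⟩, rfl⟩ ⟨b, ⟨hbO, hb⟩, hab⟩
    rw [hinj hbO haO hab] at hb
    exact lt_asymm (show 0 < a.2 from ha) hb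
  have hVU : Ψ '' O ⊆ U := by
    rintro _ ⟨z, hz, rfl⟩
    exact (hεsub hz).2
  have hV : IsOpen (Ψ '' O) := hopen isOpen_ball subset_rfl
  have hVc : IsPreconnected (Ψ '' O) :=
    (convex_ball _ _).isPreconnected.image _ (e.continuousOn.mono hOsrc)
  have hcases : ∀ x ∈ Ψ '' O, x ∈ P ∨ x ∈ N ∨ F x = 0 ∧ fderiv ℝ F x = 0 := by
    rintro _ ⟨z, hz, rfl⟩
    rcases lt_trichotomy z.2 0 with h | h | h
    · exact Or.inr (Or.inl ⟨z, ⟨hz, h⟩, rfl⟩)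
    · have hzW : z.1 ∈ W := (hεsub hz).1.2
      have hz' : Ψ z = ψ z.1 := by simp [Ψ, h]
      rw [hz']
      exact Or.inr (Or.inr ⟨hFψ _ hzW, hdF _ hzW⟩)
    · exact Or.inl ⟨z, ⟨hz, h⟩, rfl⟩
  have hG : ∀ x ∈ Ψ '' O, HasFDerivAt (P.indicator F) (P.indicator (fderiv ℝ F) x) x :=
    fun x hx => hasFDerivAt_indicator_of_eq_zero hP hN hPN (hFdiff x (hVU hx)) (hcases x hx)
  have hGC : ContDiffOn ℝ 1 (P.indicator F) (Ψ '' O) := by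
    rw [← zero_add (1 : WithTop ℕ∞), contDiffOn_succ_iff_fderiv_of_isOpen hV]
    refine ⟨fun x hx => (hG x hx).differentiableAt.differentiableWithinAt, by simp, ?_⟩
    refine contDiffOn_zero.2 <| (continuousOn_indicator_of_eq_zero hP hN hPN
      (fun x hx => (hcases x hx).imp_right (Or.imp_right And.right))
      ((hF.continuousOn_fderiv_of_isOpen hU le_rfl).mono hVU)).congr
      fun x hx => (hG x hx).fderiv
  have hGD : ∀ x ∈ Ψ '' O, dirac σ (P.indicator F) x = 0 := fun x hx => by
    unfold dirac
    rw [(hG x hx).fderiv]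
    by_cases hxP : x ∈ P
    · rw [Set.indicator_of_mem hxP]
      exact hD x (hVU hx)
    · simp [Set.indicator_of_notMem hxP]
  have hmem : ∀ t : ℝ, |t| < ε → (y₀, t) ∈ O := fun t ht => by
    simp [hO, Prod.dist_eq, ht]
  have hε2 : |ε / 2| < ε := by rw [abs_of_pos (half_pos hε)]; linarith
  have hxN : Ψ (y₀, -(ε / 2)) ∈ N :=
    ⟨_, ⟨hmem _ (by rwa [abs_neg]), neg_neg_of_pos (half_pos hε)⟩, rfl⟩
  have hxP : Ψ (y₀, ε / 2) ∈ P := ⟨_, ⟨hmem _ hε2, half_pos hε⟩, rfl⟩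
  have hGzero := eqOn_zero_of_dirac hτ hσ hB hV hVc hGC hGD
    (Set.image_mono Set.inter_subset_left hxN) (by
      filter_upwards [hN.mem_nhds hxN] with y hy
      exact Set.indicator_of_notMem (hPN.notMem_of_mem_right hy) F)
  have hPV : P ⊆ Ψ '' O := Set.image_mono Set.inter_subset_left
  refine eqOn_zero_of_dirac hτ hσ hB hU hUc hF hD (hVU (hPV hxP)) ?_
  filter_upwards [hP.mem_nhds hxP] with y hy
  have := hGzero y (hPV hy)
  rwa [Set.indicator_of_mem hy] at this

end Euclidean

section CliffordSystem

variable {A : Type*} [NormedRing A]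

/-- A family of imaginary units which anticommute pairwise. -/
structure IsCliffordSystem {κ : Type*} (c : κ → A) : Prop where
  sq (i : κ) : c i * c i = -1
  anticomm (i j : κ) (hij : i ≠ j) : c i * c j = -(c j * c i)

variable {n : ℕ} {c : Fin n → A}

theorem IsCliffordSystem.cons_neg_mul_cons (hc : IsCliffordSystem c) (i j : Fin (n + 1)) :
    (Fin.cons 1 (-c) : Fin (n + 1) → A) i * (Fin.cons 1 c : Fin (n + 1) → A) j =
      (if i = j then 1 else 0) + if i = j then 0 else
        (Fin.cons 1 (-c) : Fin (n + 1) → A) i * (Fin.cons 1 c : Fin (n + 1) → A) j := by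
  split_ifs with h
  · subst h
    refine Fin.cases ?_ (fun i => ?_) i <;> simp [hc.sq]
  · simp

theorem IsCliffordSystem.cons_neg_mul_cons_swap (hc : IsCliffordSystem c) {i j : Fin (n + 1)}
    (hij : i ≠ j) :
    (Fin.cons 1 (-c) : Fin (n + 1) → A) i * (Fin.cons 1 c : Fin (n + 1) → A) j =
      -((Fin.cons 1 (-c) : Fin (n + 1) → A) j * (Fin.cons 1 c : Fin (n + 1) → A) i) := by
  induction i using Fin.cases with
  | zero =>
    induction j using Fin.cases with
    | zero => exact absurd rfl hij
    | succ j => simp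
  | succ i =>
    induction j using Fin.cases with
    | zero => simp
    | succ j => simp [hc.anticomm i j fun h => hij (h ▸ rfl)]

variable [NormedAlgebra ℝ A]

/-- Averaging `ℓ ⊗ ℓ` over a Clifford system gives an invariant bilinear form. -/
theorem IsCliffordSystem.exists_invariant_form {κ : Type*} {c : κ → A}
    (hc : IsCliffordSystem c) (s : Finset κ) (ℓ : A →L[ℝ] ℝ) :
    ∃ B : A →L[ℝ] A →L[ℝ] ℝ, (∀ a, (ℓ a) ^ 2 ≤ B a a) ∧
      ∀ i ∈ s, ∀ a b, B (c i * a) (c i * b) = B a b := by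
  classical
  induction s using Finset.induction_on with
  | empty =>
    refine ⟨(ContinuousLinearMap.mul ℝ ℝ).bilinearComp ℓ ℓ, fun a => ?_, by simp⟩
    simp [pow_two]
  | insert k s hk ih =>
    obtain ⟨B, hB, hinv⟩ := ih
    let m := ContinuousLinearMap.mul ℝ A (c k)
    refine ⟨B + B.bilinearComp m m, fun a => ?_, fun i hi a b => ?_⟩
    · have := (sq_nonneg _).trans (hB (c k * a))
      simpa [m] using le_add_of_le_of_nonneg (hB a) this
    · rcases Finset.mem_insert.1 hi with rfl | hi
      · simp [m, ← mul_assoc, hc.sq, add_comm]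
      · have hki : k ≠ i := fun h => hk (h ▸ hi)
        simp [m, hinv i hi, ← mul_assoc, hc.anticomm k i hki]
        simp [mul_assoc, hinv i hi]

theorem IsCliffordSystem.exists_skew_form (hc : IsCliffordSystem c) (ℓ : A →L[ℝ] ℝ) :
    ∃ B : A →L[ℝ] A →L[ℝ] ℝ, (∀ (i j : Fin (n + 1)) (a b : A), i ≠ j →
      B ((Fin.cons 1 (-c) : Fin (n + 1) → A) i * (Fin.cons 1 c : Fin (n + 1) → A) j * a) b =
      -B a ((Fin.cons 1 (-c) : Fin (n + 1) → A) i * (Fin.cons 1 c : Fin (n + 1) → A) j * b)) ∧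
      ∀ a, (ℓ a) ^ 2 ≤ B a a := by
  obtain ⟨B, hB, hinv⟩ := hc.exists_invariant_form Finset.univ ℓ
  have hskew : ∀ i a b, B (c i * a) b = -B a (c i * b) := fun i a b => by
    rw [← hinv i (Finset.mem_univ i) a, ← mul_assoc, hc.sq]
    simp
  refine ⟨B, fun i j a b hij => ?_, hB⟩
  induction i using Fin.cases with
  | zero =>
    induction j using Fin.cases with
    | zero => exact absurd rfl hij
    | succ j => simp [hskew]
  | succ i =>
    induction j using Fin.cases with
    | zero => simp [hskew]
    | succ j =>
      have h := hc.anticomm j i fun h => hij (h ▸ rfl)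
      simp [mul_assoc, hskew]
      simp [← mul_assoc, h]

/-- Unique continuation across a hypersurface for the Cauchy–Riemann operator
`∂_0 + ∑ c_i ∂_{i+1}` of a Clifford system. -/
theorem IsCliffordSystem.eqOn_zero_of_dirac (hc : IsCliffordSystem c)
    {U : Set (EuclideanSpace ℝ (Fin (n + 1)))} (hU : IsOpen U) (hUc : IsPreconnected U)
    {F : EuclideanSpace ℝ (Fin (n + 1)) → A} (hF : ContDiffOn ℝ 1 F U)
    (hD : ∀ x ∈ U, dirac (Fin.cons 1 c : Fin (n + 1) → A) F x = 0)
    {ψ : (Fin n → ℝ) → EuclideanSpace ℝ (Fin (n + 1))} {W : Set (Fin n → ℝ)} (hW : IsOpen W)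
    (hψ : ContDiffOn ℝ 1 ψ W) (hψ' : ∀ y ∈ W, Function.Injective (fderiv ℝ ψ y))
    (hψU : ∀ y ∈ W, ψ y ∈ U) (hFψ : ∀ y ∈ W, F (ψ y) = 0) (hWn : W.Nonempty) :
    ∀ x ∈ U, F x = 0 := by
  obtain ⟨y₀, hy₀⟩ := hWn
  refine eqOn_zero_of_dirac_of_hypersurface (fun i j => ?_) hc.cons_neg_mul_cons (fun ℓ => ?_) hU
    hUc hF hD (by simp) hW hψ hψ' hψU hFψ hy₀
  · by_cases h : i = j
    · simp [h]
    · rw [if_neg h, if_neg (Ne.symm h)]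
      exact hc.cons_neg_mul_cons_swap h
  · obtain ⟨B, hskew, hB⟩ := hc.exists_skew_form ℓ
    refine ⟨B, fun i j a b => ?_, hB⟩
    by_cases h : i = j
    · simp [h]
    · simpa only [if_neg h] using hskew i j a b h

end CliffordSystem

end MonogenicContinuation

namespace GPS

open MonogenicContinuation

variable (p q : ℕ) {A : Type*} [NormedRing A] [NormedAlgebra ℝ A] (ξ : A ≃ₐ[ℝ] Cl (p + q))

theorem gen_mul_gen_add_swap (i j : Fin (p + q)) :
    gen p q ξ i * gen p q ξ j + gen p q ξ j * gen p q ξ i = if i = j then -2 else 0 := by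
  have h : e (p + q) i * e (p + q) j + e (p + q) j * e (p + q) i =
      if i = j then -2 else 0 := by
    rw [e, e, CliffordAlgebra.ι_mul_ι_add_swap]
    have : QuadraticMap.polar (Qe (p + q)) (Pi.single i 1) (Pi.single j 1) =
        if i = j then -2 else 0 := by
      simp only [QuadraticMap.polar, Qe, QuadraticMap.weightedSumSquares_apply, Pi.add_apply,
        smul_eq_mul, ← Finset.sum_sub_distrib]
      calc _ = ∑ k, -2 * ((Pi.single i 1 : Fin (p + q) → ℝ) k *
            (Pi.single j 1 : Fin (p + q) → ℝ) k) := Finset.sum_congr rfl fun k _ => by ring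
        _ = _ := by
          rw [← Finset.mul_sum]
          simp [Pi.single_apply, eq_comm]
    rw [this]
    split_ifs <;> simp [map_ofNat]
  have h' := congrArg ξ.symm h
  rw [map_add, map_mul, map_mul] at h'
  refine h'.trans ?_
  split_ifs <;> simp [map_ofNat]

theorem gen_mul_self (i : Fin (p + q)) : gen p q ξ i * gen p q ξ i = -1 := by
  have h := gen_mul_gen_add_swap p q ξ i i
  rw [if_pos rfl, ← two_smul ℝ] at h
  have h2 : (2 : ℝ) • (gen p q ξ i * gen p q ξ i) = (2 : ℝ) • (-1 : A) := by
    rw [h, smul_neg, two_smul]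
    norm_num
  exact smul_right_injective A (two_ne_zero (α := ℝ)) h2

theorem gen_anticomm {i j : Fin (p + q)} (hij : i ≠ j) :
    gen p q ξ i * gen p q ξ j = -(gen p q ξ j * gen p q ξ i) := by
  have h := gen_mul_gen_add_swap p q ξ i j
  rw [if_neg hij] at h
  exact eq_neg_of_add_eq_zero_left h

theorem ωCl_mul_self {v : Vq q} (hv : v ∈ S q) : ωCl p q ξ v * ωCl p q ξ v = -1 := by
  have h : (2 : ℝ) • (ωCl p q ξ v * ωCl p q ξ v) = (2 : ℝ) • (-1 : A) := by
    have hv' : ∑ j, v j * v j = 1 := by simpa only [pow_two] using (show ∑ j, v j ^ 2 = 1 from hv)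
    have hQ : ∀ i j : Fin q, eQ p q ξ i * eQ p q ξ j + eQ p q ξ j * eQ p q ξ i =
        if i = j then -2 else 0 := fun i j => by
      rw [eQ, eQ, gen_mul_gen_add_swap]
      simp [Fin.ext_iff]
    have h1 : ωCl p q ξ v * ωCl p q ξ v =
        ∑ i, ∑ j, (v i * v j) • (eQ p q ξ i * eQ p q ξ j) := by
      simp only [ωCl, Finset.sum_mul_sum, smul_mul_smul_comm]
    have h2 : ωCl p q ξ v * ωCl p q ξ v =
        ∑ i, ∑ j, (v i * v j) • (eQ p q ξ j * eQ p q ξ i) := by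
      rw [h1, Finset.sum_comm]
      exact Finset.sum_congr rfl fun i _ => Finset.sum_congr rfl fun j _ => by rw [mul_comm]
    rw [two_smul]
    nth_rewrite 1 [h1]
    rw [h2]
    simp only [← Finset.sum_add_distrib, ← smul_add, hQ, smul_ite, smul_zero, Finset.sum_ite_eq,
      Finset.mem_univ, if_true, ← Finset.sum_smul, hv', one_smul]
    rw [smul_neg, two_smul, one_add_one_eq_two]
  exact smul_right_injective A (two_ne_zero (α := ℝ)) h

theorem eP_mul_ωCl (i : Fin p) (v : Vq q) :
    eP p q ξ i * ωCl p q ξ v = -(ωCl p q ξ v * eP p q ξ i) := by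
  simp only [ωCl, Finset.mul_sum, Finset.sum_mul, ← Finset.sum_neg_distrib]
  refine Finset.sum_congr rfl fun j _ => ?_
  rw [mul_smul_comm, smul_mul_assoc, ← smul_neg, eP, eQ, gen_anticomm]
  simp only [ne_eq, Fin.mk.injEq]
  omega

theorem isCliffordSystem_snoc {v : Vq q} (hv : v ∈ S q) :
    IsCliffordSystem (Fin.snoc (eP p q ξ) (ωCl p q ξ v) : Fin (p + 1) → A) where
  sq i := by
    induction i using Fin.lastCases with
    | last => simpa using ωCl_mul_self p q ξ hv
    | cast i =>
      rw [Fin.snoc_castSucc]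
      exact gen_mul_self p q ξ _
  anticomm i j hij := by
    induction i using Fin.lastCases with
    | last =>
      induction j using Fin.lastCases with
      | last => exact absurd rfl hij
      | cast j => simp [eP_mul_ωCl]
    | cast i =>
      induction j using Fin.lastCases with
      | last => simpa using eP_mul_ωCl p q ξ i v
      | cast j =>
        simp only [Fin.snoc_castSucc]
        refine gen_anticomm p q ξ fun h => hij ?_
        simpa [Fin.ext_iff] using h

theorem εp_eq_cons : εp p q ξ = Fin.cons 1 (eP p q ξ) := by
  funext i
  refine Fin.cases ?_ (fun i => ?_) i <;> simp [εp, eP]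

/-- Euclidean coordinates on the parameter space of a slice. -/
def slEquiv : EuclideanSpace ℝ (Fin (p + 2)) ≃L[ℝ] Sl p :=
  LinearEquiv.toContinuousLinearEquiv
    { toFun := fun x => (fun i => x i.castSucc, x (Fin.last (p + 1)))
      invFun := fun z => WithLp.toLp 2 (Fin.snoc z.1 z.2)
      map_add' := fun _ _ => rfl
      map_smul' := fun _ _ => rfl
      left_inv := fun x => by
        ext i
        refine Fin.lastCases ?_ (fun i => ?_) i <;> simp
      right_inv := fun z => by ext <;> simp }

theorem slEquiv_apply (x : EuclideanSpace ℝ (Fin (p + 2))) :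
    slEquiv p x = (fun i => x i.castSucc, x (Fin.last (p + 1))) := rfl

theorem slEquiv_single_castSucc (i : Fin (p + 1)) :
    slEquiv p (EuclideanSpace.single i.castSucc 1) = (Pi.single i 1, 0) := by
  ext j
  · simp [slEquiv_apply, Pi.single_apply]
  · simp [slEquiv_apply]

theorem slEquiv_single_last :
    slEquiv p (EuclideanSpace.single (Fin.last (p + 1)) 1) = (0, 1) := by
  ext j
  · simp [slEquiv_apply]
  · simp [slEquiv_apply]

theorem dirac_comp_slEquiv {v : Vq q} {F : Sl p → A} {x : EuclideanSpace ℝ (Fin (p + 2))} :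
    dirac (Fin.cons 1 (Fin.snoc (eP p q ξ) (ωCl p q ξ v)) : Fin (p + 2) → A)
      (F ∘ slEquiv p) x =
      DP p q ξ F (slEquiv p x) + ωCl p q ξ v * pdr p F (slEquiv p x) := by
  rw [Fin.cons_snoc_eq_snoc_cons, ← εp_eq_cons]
  simp [dirac, Fin.sum_univ_castSucc, DP, pdr, pdSl, ContinuousLinearEquiv.comp_right_fderiv,
    slEquiv_single_castSucc, slEquiv_single_last]

variable {p q ξ}

/-- Slice functions which agree on an immersed hypersurface patch of a slice agree on the slice. -/
theorem GSMOn.eqOn_slice {Ω : Set (V p q)} (hΩ : IsSliceDomain p q Ω) {f g : V p q → A}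
    (hf : GSMOn p q ξ Ω f) (hg : GSMOn p q ξ Ω g) {v : Vq q} (hv : v ∈ S q)
    {ψ : Vp p → Sl p} {W : Set (Vp p)} (hW : IsOpen W) (hWn : W.Nonempty)
    (hψ : ContDiffOn ℝ 1 ψ W) (hψ' : ∀ y ∈ W, Function.Injective (fderiv ℝ ψ y))
    (hψΩ : ∀ y ∈ W, ψ y ∈ sliceSet p q Ω v)
    (hfg : ∀ y ∈ W, f (spt p q v (ψ y)) = g (spt p q v (ψ y))) :
    ∀ z ∈ sliceSet p q Ω v, f (spt p q v z) = g (spt p q v z) := by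
  obtain ⟨hopen, hconn⟩ := hΩ.2.2 v hv
  obtain ⟨hf1, hf2⟩ := hf v hv
  obtain ⟨hg1, hg2⟩ := hg v hv
  let L := slEquiv p
  let F : Sl p → A := fun z => f (spt p q v z) - g (spt p q v z)
  have hF : ContDiffOn ℝ 1 F (sliceSet p q Ω v) := hf1.sub hg1
  have hFD : ∀ z ∈ sliceSet p q Ω v, DP p q ξ F z + ωCl p q ξ v * pdr p F z = 0 := fun z hz => by
    have hd : fderiv ℝ F z = fderiv ℝ (fun z => f (spt p q v z)) z -
        fderiv ℝ (fun z => g (spt p q v z)) z :=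
      fderiv_fun_sub ((hf1.contDiffAt (hopen.mem_nhds hz)).differentiableAt (by simp))
        ((hg1.contDiffAt (hopen.mem_nhds hz)).differentiableAt (by simp))
    have h := congrArg₂ (· - ·) (hf2 z hz) (hg2 z hz)
    simp only [DP, pdr, pdSl] at h ⊢
    rw [hd]
    simp only [sub_zero, sub_apply, mul_sub, Finset.sum_sub_distrib] at h ⊢
    rw [← h]
    abel
  have key := (isCliffordSystem_snoc p q ξ hv).eqOn_zero_of_dirac (U := L ⁻¹' sliceSet p q Ω v)
    (F := F ∘ L) (ψ := L.symm ∘ ψ) (hopen.preimage L.continuous) ?_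
    (hF.comp L.contDiff.contDiffOn (Set.mapsTo_preimage _ _)) (fun x hx => ?_) hW
    (L.symm.contDiff.comp_contDiffOn hψ) (fun y hy => ?_) (fun y hy => ?_) (fun y hy => ?_) hWn
  · intro z hz
    have := key (L.symm z) (by simpa using hz)
    simpa [F, sub_eq_zero] using this
  · rw [← L.image_symm_eq_preimage]
    exact hconn.isPreconnected.image _ L.symm.continuous.continuousOn
  · exact (dirac_comp_slEquiv p q ξ).trans (hFD _ hx)
  · rw [L.symm.comp_fderiv]
    exact L.symm.injective.comp (hψ' y hy)
  · simpa using hψΩ y hy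
  · simpa [F, sub_eq_zero] using hfg y hy

theorem mem_S_of_norm_eq_one {v : Vq q} (hv : ‖v‖ = 1) : v ∈ S q := by
  show ∑ j, v j ^ 2 = 1
  rw [← EuclideanSpace.real_norm_sq_eq, hv, one_pow]

end GPS

open GPS

/-- **Identity theorem** (Theorem 2.5).  Let `Ω ⊆ ℝ^{p+q+1}` be a slice domain and
`f, g : Ω → ℝ_{p+q}` left generalized partial-slice monogenic functions of type `(p,q)`.
If there is `ω ∈ 𝕊` such that `f = g` on a `(p+1)`-dimensional smooth submanifold
contained in `Ω_ω`, then `f ≡ g` on `Ω`. -/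
theorem identity_theorem
    (p q : ℕ) (hq : 1 ≤ q) {A : Type*} [NormedRing A] [NormedAlgebra ℝ A]
    (ξ : A ≃ₐ[ℝ] Cl (p + q))
    (Ω : Set (V p q)) (hΩ : IsSliceDomain p q Ω)
    (f g : V p q → A)
    (hf : GSMOn p q ξ Ω f) (hg : GSMOn p q ξ Ω g)
    (v : Vq q) (hv : v ∈ S q)
    (M : Set (Sl p)) (hM : M.Nonempty) (hMsub : M ⊆ sliceSet p q Ω v)
    (hMan : IsSmoothSubmanifoldDim (p + 1) M)
    (heq : ∀ z ∈ M, f (spt p q v z) = g (spt p q v z)) :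
    Set.EqOn f g Ω := by
  have hslice : ∀ z ∈ sliceSet p q Ω v, f (spt p q v z) = g (spt p q v z) := by
    obtain ⟨z, hz⟩ := hM
    obtain ⟨U, -, hzU, ψ, W, hW, hψ, -, hψ', hMU⟩ := hMan z hz
    have hψM : ∀ y ∈ W, ψ y ∈ M := fun y hy => (hMU ▸ Set.mem_image_of_mem ψ hy : ψ y ∈ M ∩ U).1
    refine GSMOn.eqOn_slice hΩ hf hg hv hW ?_ (hψ.of_le (by simp)) (fun y hy => ?_)
      (fun y hy => hMsub (hψM y hy)) fun y hy => heq _ (hψM y hy)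
    · have hne : (M ∩ U).Nonempty := ⟨z, hz, hzU⟩
      rwa [hMU, Set.image_nonempty] at hne
    · rw [← fderivWithin_of_isOpen hW hy]
      exact hψ' y hy
  have hflat : ∀ w ∈ S q, ∀ z ∈ sliceSet p q Ω w, f (spt p q w z) = g (spt p q w z) := by
    intro w hw
    have hψ : ∀ y, HasFDerivAt (fun x : Vp p => ((x, 0) : Sl p))
        (ContinuousLinearMap.inl ℝ (Vp p) ℝ) y := fun y =>
      (ContinuousLinearMap.inl ℝ (Vp p) ℝ).hasFDerivAt
    refine GSMOn.eqOn_slice hΩ hf hg hw (ψ := fun x => (x, 0)) (W := {x | (x, 0) ∈ Ω})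
      (hΩ.1.1.preimage (by fun_prop)) hΩ.2.1 (by fun_prop) (fun y _ => ?_) (fun y hy => ?_)
      fun y hy => ?_
    · rw [(hψ y).fderiv]
      exact LinearMap.inl_injective
    · simpa [sliceSet, spt] using hy
    · simpa [spt] using hslice (y, 0) (by simpa [sliceSet, spt] using hy)
  rintro ⟨x, y⟩ hxy
  obtain ⟨w, hw, r, rfl⟩ : ∃ w ∈ S q, ∃ r : ℝ, r • w = y := by
    rcases eq_or_ne y 0 with rfl | hy
    · exact ⟨v, hv, 0, zero_smul _ _⟩
    · have hy' : ‖y‖ ≠ 0 := norm_ne_zero_iff.2 hy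
      exact ⟨‖y‖⁻¹ • y, mem_S_of_norm_eq_one (by simp [norm_smul, hy']), ‖y‖,
        smul_inv_smul₀ hy' y⟩
  exact hflat w hw (x, r) hxy
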